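/- Let n, m ∈ ℕ with n, m ≥ 1, let A ∈ ℝ^{n×n}, B ∈ ℝ^{n×m}, K ∈ ℝ^{m×n}, and h̄ ∈ ℕ, h̄ ≥ 1; set A_cl := A + BK and λ := λmax(E_{h̄}). Suppose A_cl is Schur (all complex eigenvalues have modulus < 1), so that for each ω ∈ ℝ the n×n complex matrix G(e^{iω}) := (I − A_cl)(e^{iω}I − A_cl)^{−1}BK − BK is well defined. Suppose there exist symmetric X ≻ 0 and Y ⪰ 0 in ℝ^{n×n} such that for all ω with |ω| ≤ π, the Hermitian matrix G(e^{iω})*(λX + Y)G(e^{iω}) + G(e^{iω})*Y + Y·G(e^{iω}) − X is negative definite. Then the origin of the aperiodically sampled closed loop is asymptotically stable: for every sampling sequence with intervals h_k ∈ {1,…,h̄} and every x₀, x(s) → 0 as s → ∞, and for every ε > 0 there is δ > 0 such that ‖x₀‖ < δ implies ‖x(s)‖ < ε for all s and all such sampling sequences. -/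

import Mathlib

open Matrix Finset Complex
open scoped ComplexOrder

/-- The `h × h` matrix with entries `min i j` (zero-based indices). -/
noncomputable def Emat (h : ℕ) : Matrix (Fin h) (Fin h) ℝ :=
  fun i j => (min (i : ℕ) (j : ℕ) : ℝ)

lemma Emat_isHermitian (h : ℕ) : (Emat h).IsHermitian := by
  ext i j
  simp [Emat, Matrix.conjTranspose_apply, min_comm]

/-- The largest eigenvalue of `Emat h`. -/
noncomputable def lamMax (h : ℕ) : ℝ := ⨆ i, (Emat_isHermitian h).eigenvalues i

/-- `x` is the closed-loop trajectory of the aperiodically sampled system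
`x(s+1) = A x(s) + B K x(t k)` for `s ∈ {t k, …, t (k+1) − 1}`, starting from `x₀`. -/
def IsTraj {n m : ℕ} (A : Matrix (Fin n) (Fin n) ℝ) (B : Matrix (Fin n) (Fin m) ℝ)
    (K : Matrix (Fin m) (Fin n) ℝ) (t : ℕ → ℕ) (x₀ : EuclideanSpace ℝ (Fin n))
    (x : ℕ → EuclideanSpace ℝ (Fin n)) : Prop :=
  x 0 = x₀ ∧ ∀ k s : ℕ, t k ≤ s → s < t (k + 1) →
    x (s + 1) = A *ᵥ x s + B *ᵥ (K *ᵥ x (t k))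


lemma fds_rayleigh (h : ℕ) (v : Fin h → ℝ) :
    v ⬝ᵥ (Emat h *ᵥ v) ≤ lamMax h * (v ⬝ᵥ v) := by
  have hps : (algebraMap ℝ (Matrix (Fin h) (Fin h) ℝ) (lamMax h) - Emat h).PosSemidef := by
    rw [Matrix.posSemidef_iff_isHermitian_and_spectrum_nonneg]
    constructor
    · refine Matrix.IsHermitian.sub ?_ (Emat_isHermitian h)
      ext i j
      simp [Matrix.algebraMap_matrix_apply, eq_comm]
    · intro a ha
      rw [← spectrum.singleton_sub_eq, (Emat_isHermitian h).spectrum_real_eq_range_eigenvalues] at ha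
      obtain ⟨b, hb, c, ⟨i, rfl⟩, rfl⟩ := ha
      rw [Set.mem_singleton_iff] at hb
      subst hb
      have : (Emat_isHermitian h).eigenvalues i ≤ lamMax h :=
        le_ciSup (Set.finite_range _).bddAbove i
      simpa using this
  have := hps.dotProduct_mulVec_nonneg v
  rw [Algebra.algebraMap_eq_smul_one, Matrix.sub_mulVec, Matrix.smul_mulVec, Matrix.one_mulVec,
    dotProduct_sub, dotProduct_smul] at this
  simp only [star_trivial, smul_eq_mul] at this
  linarith

lemma fds_Equad (H : ℕ) (v : ℕ → ℝ) :
    ∑ j ∈ range H, (∑ i ∈ (range H).filter (fun i => j < i), v i) ^ 2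
      ≤ lamMax H * ∑ i ∈ range H, v i ^ 2 := by
  have h1 := fds_rayleigh H (fun i => v i)
  have h2 : (fun i : Fin H => v i) ⬝ᵥ (fun i : Fin H => v i) = ∑ i ∈ range H, v i ^ 2 := by
    simp only [dotProduct]
    rw [Fin.sum_univ_eq_sum_range (fun i => v i * v i)]
    simp [sq]
  have h3 : (fun i : Fin H => v i) ⬝ᵥ (Emat H *ᵥ (fun i : Fin H => v i))
      = ∑ j ∈ range H, (∑ i ∈ (range H).filter (fun i => j < i), v i) ^ 2 := by
    have : ∀ i : ℕ, ∑ k : Fin H, (min i (k:ℕ) : ℝ) * v k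
        = ∑ k ∈ range H, (min i k : ℝ) * v k := fun i => by
      rw [← Fin.sum_univ_eq_sum_range (fun k => (min i k : ℝ) * v k)]
    simp only [dotProduct, mulVec, Emat, this]
    rw [Fin.sum_univ_eq_sum_range (fun i => v i * ∑ k ∈ range H, (min i k : ℝ) * v k)]
    have hr : ∀ j, (∑ i ∈ (range H).filter (fun i => j < i), v i) ^ 2
        = ∑ i ∈ range H, ∑ k ∈ range H,
          (if j < i then v i else 0) * (if j < k then v k else 0) := fun j => by
      rw [sum_filter, sq, sum_mul_sum]
    rw [sum_congr rfl (fun j _ => hr j), sum_comm]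
    refine sum_congr rfl fun i hi => ?_
    rw [mul_sum, sum_comm]
    refine sum_congr rfl fun k hk => ?_
    rw [mem_range] at hi hk
    have : (min i k : ℝ) = ∑ j ∈ range H, if j < i ∧ j < k then (1:ℝ) else 0 := by
      rw [← sum_filter]
      have : (range H).filter (fun j => j < i ∧ j < k) = range (min i k) := by
        ext j; simp; omega
      rw [this]; simp
    rw [this, sum_mul, mul_sum]
    refine sum_congr rfl fun j _ => ?_
    by_cases h1 : j < i <;> by_cases h2 : j < k <;> simp [h1, h2]
  rw [h2, h3] at h1
  exact h1

lemma fds_lam_nonneg (H : ℕ) (hH : 1 ≤ H) : 0 ≤ lamMax H := by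
  have h1 := fds_Equad H (fun i => if i = 0 then 1 else 0)
  have h2 : ∑ i ∈ range H, (if i = 0 then (1:ℝ) else 0) ^ 2 = 1 := by
    rw [sum_eq_single 0] <;> simp <;> omega
  rw [h2, mul_one] at h1
  exact le_trans (sum_nonneg fun _ _ => sq_nonneg _) h1

lemma fds_scalar (H h : ℕ) (hH : 1 ≤ H) (hh : h ≤ H) (f : ℕ → ℝ) :
    ∑ i ∈ range h, (∑ j ∈ range i, f j) ^ 2 ≤ lamMax H * ∑ j ∈ range h, f j ^ 2 := by
  set v : ℕ → ℝ := fun i => if i < h then ∑ j ∈ range i, f j else 0 with hv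
  set S := ∑ i ∈ range h, (∑ j ∈ range i, f j) ^ 2 with hS
  have hS0 : 0 ≤ S := sum_nonneg fun _ _ => sq_nonneg _
  have hf0 : 0 ≤ ∑ j ∈ range h, f j ^ 2 := sum_nonneg fun _ _ => sq_nonneg _
  have hvS : ∑ i ∈ range H, v i ^ 2 = S := by
    rw [hS, ← sum_subset (range_subset_range.2 hh)]
    · refine sum_congr rfl fun i hi => ?_
      simp [hv, mem_range.1 hi]
    · intro i _ hi
      have : ¬ i < h := by simpa using hi
      simp [hv, this]
  set w : ℕ → ℝ := fun j => ∑ i ∈ (range H).filter (fun i => j < i), v i with hw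
  have hE : ∑ j ∈ range H, w j ^ 2 ≤ lamMax H * S := by
    rw [← hvS]; exact fds_Equad H v
  have hcross : S = ∑ j ∈ range h, f j * w j := by
    have : ∀ j, w j = ∑ i ∈ range h, if j < i then v i else 0 := fun j => by
      rw [hw]
      simp only [sum_filter]
      symm
      apply sum_subset (range_subset_range.2 hh)
      intro i _ hi
      have : ¬ i < h := by simpa using hi
      simp [hv, this]
    simp only [this, mul_sum]
    rw [sum_comm, hS]
    refine sum_congr rfl fun i hi => ?_
    have hi' := mem_range.1 hi
    rw [sq, sum_mul]
    simp only [hv, hi', if_true]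
    rw [← sum_subset (s₁ := range i) (range_subset_range.2 hi'.le)]
    · refine sum_congr rfl fun j hj => ?_
      simp [mem_range.1 hj]
    · intro j _ hj
      have : ¬ j < i := by simpa using hj
      simp [this]
  have hcs : S ^ 2 ≤ (∑ j ∈ range h, f j ^ 2) * (∑ j ∈ range h, w j ^ 2) := by
    rw [hcross]; exact sum_mul_sq_le_sq_mul_sq _ _ _
  have hsub : ∑ j ∈ range h, w j ^ 2 ≤ ∑ j ∈ range H, w j ^ 2 :=
    sum_le_sum_of_subset_of_nonneg (range_subset_range.2 hh) fun _ _ _ => sq_nonneg _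
  have hlam := fds_lam_nonneg H hH
  have h4 : S * S ≤ (lamMax H * ∑ j ∈ range h, f j ^ 2) * S := by
    have := mul_le_mul_of_nonneg_left (hsub.trans hE) hf0
    nlinarith
  rcases hS0.eq_or_lt with h0 | h0
  · rw [← h0]; positivity
  · exact le_of_mul_le_mul_right h4 h0

open scoped MatrixOrder in
lemma fds_vec {n : ℕ} (H h : ℕ) (hH : 1 ≤ H) (hh : h ≤ H) (X : Matrix (Fin n) (Fin n) ℝ)
    (hX : X.PosSemidef) (f : ℕ → Fin n → ℝ) :
    ∑ i ∈ range h, (∑ j ∈ range i, f j) ⬝ᵥ (X *ᵥ (∑ j ∈ range i, f j))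
      ≤ lamMax H * ∑ j ∈ range h, f j ⬝ᵥ (X *ᵥ f j) := by
  obtain ⟨S, rfl⟩ : ∃ S : Matrix (Fin n) (Fin n) ℝ, X = Sᴴ * S := by
    obtain ⟨S, hS, -, h⟩ := CFC.exists_sqrt_of_isSelfAdjoint_of_quasispectrumRestricts
      hX.isHermitian (QuasispectrumRestricts.nnreal_of_nonneg hX.nonneg)
    exact ⟨S, by rw [← star_eq_conjTranspose, hS.star_eq]; exact h.symm⟩
  have key : ∀ v : Fin n → ℝ, v ⬝ᵥ ((Sᴴ * S) *ᵥ v) = ∑ a, (S *ᵥ v) a ^ 2 := fun v => by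
    rw [← mulVec_mulVec, dotProduct_mulVec, conjTranspose_eq_transpose_of_trivial, vecMul_transpose]
    simp [dotProduct, sq]
  simp only [key]
  rw [sum_comm, sum_comm (s := range h), mul_sum]
  refine sum_le_sum fun a _ => ?_
  have := fds_scalar H h hH hh (fun j => (S *ᵥ f j) a)
  have hm : ∀ i, S *ᵥ (∑ j ∈ range i, f j) = ∑ j ∈ range i, S *ᵥ f j := fun i => by
    simp only [← mulVecLin_apply]; exact map_sum _ _ _
  simpa only [hm, Finset.sum_apply] using this

lemma fds_pow_tendsto {n : ℕ} (hn : 1 ≤ n) (M : Matrix (Fin n) (Fin n) ℝ)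
    (hS : ∀ μ ∈ spectrum ℂ (M.map Complex.ofReal), ‖μ‖ < 1) (v : Fin n → ℝ) :
    Filter.Tendsto (fun k : ℕ => (M ^ k) *ᵥ v) Filter.atTop (nhds 0) := by
  have : Nonempty (Fin n) := ⟨⟨0, hn⟩⟩
  let _ : NormedRing (Matrix (Fin n) (Fin n) ℂ) := Matrix.linftyOpNormedRing
  let _ : NormedAlgebra ℂ (Matrix (Fin n) (Fin n) ℂ) := Matrix.linftyOpNormedAlgebra
  have : CompleteSpace (Matrix (Fin n) (Fin n) ℂ) := FiniteDimensional.complete ℂ _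
  set a := M.map Complex.ofReal with ha
  have hr : spectralRadius ℂ a < (1 : NNReal) :=
    spectrum.spectralRadius_lt_of_forall_lt a (fun z hz => by
      have := hS z hz
      exact_mod_cast this)
  obtain ⟨r, hr1, hr2⟩ := ENNReal.lt_iff_exists_nnreal_btwn.1 hr
  have hr2' : r < 1 := by exact_mod_cast hr2
  have hg := spectrum.pow_nnnorm_pow_one_div_tendsto_nhds_spectralRadius a
  have hev : ∀ᶠ k : ℕ in Filter.atTop, ‖a ^ k‖ ≤ (r : ℝ) ^ k := by
    filter_upwards [hg.eventually_lt_const hr1, Filter.eventually_gt_atTop 0] with k hk hk0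
    have h1 := ENNReal.rpow_lt_rpow hk (z := (k : ℝ)) (by exact_mod_cast hk0)
    rw [← ENNReal.rpow_mul, one_div, inv_mul_cancel₀ (by positivity), ENNReal.rpow_one,
      ENNReal.rpow_natCast] at h1
    have h2 : ‖a ^ k‖₊ < r ^ k := by exact_mod_cast h1
    exact_mod_cast h2.le
  have hp : Filter.Tendsto (fun k : ℕ => a ^ k) Filter.atTop (nhds 0) := by
    refine squeeze_zero_norm' hev ?_
    exact tendsto_pow_atTop_nhds_zero_of_lt_one r.2 (by exact_mod_cast hr2')
  have hent : ∀ i j, Filter.Tendsto (fun k : ℕ => (M ^ k) i j) Filter.atTop (nhds 0) := by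
    intro i j
    have h1 : Filter.Tendsto (fun k : ℕ => (a ^ k) i j) Filter.atTop (nhds 0) := by
      refine squeeze_zero_norm (a := fun k => ‖a ^ k‖) (fun k => ?_) (by simpa using hp.norm)
      have : ‖(a ^ k) i j‖₊ ≤ ‖a ^ k‖₊ := by
        rw [Matrix.linfty_opNNNorm_def]
        exact (Finset.single_le_sum (f := fun j => ‖(a ^ k) i j‖₊) (fun _ _ => zero_le)
          (Finset.mem_univ j)).trans
          (Finset.le_sup (f := fun i => ∑ j, ‖(a ^ k) i j‖₊) (Finset.mem_univ i))
      exact_mod_cast this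
    have h2 : ∀ k, (a ^ k) i j = (((M ^ k) i j : ℝ) : ℂ) := fun k => by
      have : a ^ k = (M ^ k).map Complex.ofReal := by
        rw [ha]; exact (map_pow (Complex.ofRealHom.mapMatrix) M k).symm
      rw [this]; rfl
    simp only [h2] at h1
    have := (Complex.continuous_re.tendsto _).comp h1
    simpa [Function.comp_def] using this
  rw [tendsto_pi_nhds]
  intro i
  simp only [mulVec, dotProduct, Pi.zero_apply]
  have : Filter.Tendsto (fun k : ℕ => ∑ j, (M ^ k) i j * v j) Filter.atTop
      (nhds (∑ j, 0 * v j)) := tendsto_finsetSum _ fun j _ => (hent i j).mul_const _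
  simpa using this

/-- the DFT-like transform -/
noncomputable def fdsT {n : ℕ} (N : ℕ) (u : ℂ) (x : ℕ → Fin n → ℂ) : Fin n → ℂ :=
  ∑ s ∈ range N, u ^ s • x s

lemma fds_orth (N : ℕ) (hN : 0 < N) (ζ : ℂ) (hζ : IsPrimitiveRoot ζ N) (s r : ℕ)
    (hs : s < N) (hr : r < N) :
    ∑ j ∈ range N, (starRingEnd ℂ) ((ζ ^ j) ^ s) * (ζ ^ j) ^ r = if s = r then (N : ℂ) else 0 := by
  have hz : ζ ≠ 0 := hζ.ne_zero hN.ne'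
  have hc : (starRingEnd ℂ) ζ = ζ⁻¹ := by
    rw [Complex.inv_def, Complex.normSq_eq_norm_sq, hζ.norm'_eq_one hN.ne']
    simp
  have h1 : ∀ j, (starRingEnd ℂ) ((ζ ^ j) ^ s) * (ζ ^ j) ^ r = (ζ⁻¹ ^ s * ζ ^ r) ^ j := fun j => by
    rw [map_pow, map_pow, hc]; ring
  simp only [h1]
  split_ifs with h
  · subst h
    simp [hz]
  · have hne : ζ⁻¹ ^ s * ζ ^ r ≠ 1 := by
      intro h2
      apply h
      apply hζ.pow_inj hs hr
      rw [inv_pow, inv_mul_eq_one₀ (pow_ne_zero _ hz)] at h2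
      exact h2
    rw [geom_sum_eq hne]
    have : (ζ⁻¹ ^ s * ζ ^ r) ^ N = 1 := by
      rw [mul_pow, ← pow_mul, ← pow_mul, mul_comm s, mul_comm r, pow_mul, pow_mul, inv_pow,
        hζ.pow_eq_one]
      simp
    rw [this]; simp

lemma fds_parseval {n : ℕ} (N : ℕ) (hN : 0 < N) (ζ : ℂ) (hζ : IsPrimitiveRoot ζ N)
    (x y : ℕ → Fin n → ℂ) :
    ∑ j ∈ range N, star (fdsT N (ζ ^ j) x) ⬝ᵥ fdsT N (ζ ^ j) y
      = N * ∑ s ∈ range N, star (x s) ⬝ᵥ y s := by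
  have h1 : ∀ j, star (fdsT N (ζ ^ j) x) ⬝ᵥ fdsT N (ζ ^ j) y
      = ∑ s ∈ range N, ∑ r ∈ range N,
        ((starRingEnd ℂ) ((ζ ^ j) ^ s) * (ζ ^ j) ^ r) * (star (x s) ⬝ᵥ y r) := fun j => by
    simp only [fdsT, star_sum, sum_dotProduct, star_smul, smul_dotProduct, smul_eq_mul]
    simp only [dotProduct_sum, dotProduct_smul, smul_eq_mul, mul_sum]
    refine sum_congr rfl fun s _ => sum_congr rfl fun r _ => ?_
    rw [starRingEnd_apply]; ring
  simp only [h1]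
  rw [sum_comm, mul_sum]
  refine sum_congr rfl fun s hs => ?_
  rw [sum_comm]
  have : ∀ r ∈ range N, ∑ j ∈ range N, ((starRingEnd ℂ) ((ζ ^ j) ^ s) * (ζ ^ j) ^ r)
      * (star (x s) ⬝ᵥ y r) = if s = r then N * (star (x s) ⬝ᵥ y r) else 0 := fun r hr => by
    rw [← sum_mul, fds_orth N hN ζ hζ s r (mem_range.1 hs) (mem_range.1 hr)]
    split_ifs <;> simp
  rw [sum_congr rfl this]
  simp only [sum_ite_eq, hs, if_true]

lemma fdsT_mulVec {n : ℕ} (N : ℕ) (u : ℂ) (M : Matrix (Fin n) (Fin n) ℂ) (x : ℕ → Fin n → ℂ) :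
    fdsT N u (fun s => M *ᵥ x s) = M *ᵥ fdsT N u x := by
  simp only [fdsT, ← mulVecLin_apply, map_sum, map_smul]

lemma fdsT_add {n : ℕ} (N : ℕ) (u : ℂ) (x y : ℕ → Fin n → ℂ) :
    fdsT N u (fun s => x s + y s) = fdsT N u x + fdsT N u y := by
  simp only [fdsT, smul_add, sum_add_distrib]

lemma fdsT_sub {n : ℕ} (N : ℕ) (u : ℂ) (x y : ℕ → Fin n → ℂ) :
    fdsT N u (fun s => x s - y s) = fdsT N u x - fdsT N u y := by
  simp only [fdsT, smul_sub, sum_sub_distrib]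

lemma fdsT_shift {n : ℕ} (N : ℕ) (u : ℂ) (hu : u ≠ 0) (huN : u ^ N = 1) (x : ℕ → Fin n → ℂ) :
    fdsT N u (fun s => x (s + 1)) = u⁻¹ • fdsT N u x - u⁻¹ • (x 0 - x N) := by
  have h1 := sum_range_succ (fun s => u ^ s • x s) N
  have h2 := sum_range_succ' (fun s => u ^ s • x s) N
  have h3 : fdsT N u (fun s => x (s + 1)) = u⁻¹ • ∑ k ∈ range N, u ^ (k + 1) • x (k + 1) := by
    rw [fdsT, smul_sum]
    refine sum_congr rfl fun s _ => ?_
    rw [smul_smul, pow_succ']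
    congr 1
    field_simp
  have h4 : ∑ k ∈ range N, u ^ (k + 1) • x (k + 1) = fdsT N u x - (x 0 - x N) := by
    rw [h1] at h2
    simp only [huN, pow_zero, one_smul] at h2
    rw [fdsT, sub_sub_eq_add_sub, h2]; simp
  rw [h3, h4, smul_sub]

/-- the complex quadratic supply rate -/
noncomputable def fdsSig {n : ℕ} (l : ℂ) (X Y : Matrix (Fin n) (Fin n) ℂ) (e y : Fin n → ℂ) : ℂ :=
  l * (star y ⬝ᵥ (X *ᵥ y)) + star y ⬝ᵥ (Y *ᵥ y) + star e ⬝ᵥ (Y *ᵥ y) + star y ⬝ᵥ (Y *ᵥ e)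
    - star e ⬝ᵥ (X *ᵥ e)

lemma fdsSig_smul {n : ℕ} (l : ℂ) (X Y : Matrix (Fin n) (Fin n) ℂ) (e y : Fin n → ℂ) (r : ℝ) :
    fdsSig l X Y ((r : ℂ) • e) ((r : ℂ) • y) = ((r ^ 2 : ℝ) : ℂ) * fdsSig l X Y e y := by
  simp only [fdsSig, mulVec_smul, star_smul, smul_dotProduct, dotProduct_smul, smul_eq_mul,
    Complex.star_def, Complex.conj_ofReal]
  push_cast
  ring

lemma fds_compact {α : Type*} [TopologicalSpace α] {S : Set α} (hS : IsCompact S) (f g : α → ℝ)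
    (hf : Continuous f) (hg : Continuous g) (hg0 : ∀ p ∈ S, 0 ≤ g p)
    (hneg : ∀ p ∈ S, g p = 0 → f p < 0) :
    ∃ δ > 0, ∃ C : ℝ, 0 ≤ C ∧ ∀ p ∈ S, f p + δ ≤ C * g p := by
  obtain ⟨k, hk⟩ : ∃ k : ℕ, S ⊆ {p | f p < k * max (g p) 0} := by
    refine hS.elim_directed_cover (fun k : ℕ => {p | f p < k * max (g p) 0})
      (fun k => isOpen_lt hf (continuous_const.mul (hg.max continuous_const))) ?_ ?_
    · intro p hp
      rcases (hg0 p hp).eq_or_lt with h | h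
      · exact Set.mem_iUnion.2 ⟨0, by simpa using hneg p hp h.symm⟩
      · obtain ⟨k, hk⟩ := exists_nat_gt (f p / g p)
        refine Set.mem_iUnion.2 ⟨k, ?_⟩
        rw [div_lt_iff₀ h] at hk
        simpa [max_eq_left h.le] using hk
    · apply Monotone.directed_le
      intro a b hab p hp
      have : (a : ℝ) * max (g p) 0 ≤ b * max (g p) 0 :=
        mul_le_mul_of_nonneg_right (by exact_mod_cast hab) (le_max_right _ _)
      exact lt_of_lt_of_le hp this
  rcases S.eq_empty_or_nonempty with h0 | hne
  · exact ⟨1, one_pos, 0, le_rfl, by simp [h0]⟩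
  obtain ⟨q, hq, hmin⟩ := hS.exists_isMinOn hne
    (f := fun p => k * g p - f p) (by fun_prop)
  refine ⟨k * g q - f q, ?_, k, by positivity, fun p hp => ?_⟩
  · have : f q < k * max (g q) 0 := hk hq
    rw [max_eq_left (hg0 q hq)] at this
    linarith
  · have : k * g q - f q ≤ k * g p - f p := hmin hp
    linarith

lemma fds_normsq {n : ℕ} (w : Fin n → ℂ) : (star w ⬝ᵥ w).re = ∑ i, ‖w i‖ ^ 2 := by
  simp only [dotProduct, Pi.star_apply, Complex.star_def, Complex.re_sum]
  refine sum_congr rfl fun i _ => ?_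
  rw [mul_comm, Complex.mul_conj, Complex.ofReal_re, Complex.normSq_eq_norm_sq]

lemma fds_point {n : ℕ} (hn : 1 ≤ n) (l : ℂ) (X Y M D : Matrix (Fin n) (Fin n) ℂ)
    (hneg : ∀ z : ℂ, ‖z‖ = 1 → ∀ x e : Fin n → ℂ, z • x = M *ᵥ x + D *ᵥ e → (x, e) ≠ 0 →
      (fdsSig l X Y e (x - (M *ᵥ x + D *ᵥ e))).re < 0) :
    ∃ ε > 0, ∃ C : ℝ, 0 ≤ C ∧ ∀ z : ℂ, ‖z‖ = 1 → ∀ x e : Fin n → ℂ,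
      (fdsSig l X Y e (x - (M *ᵥ x + D *ᵥ e))).re + ε * (star x ⬝ᵥ x).re
        ≤ C * (star (z • x - (M *ᵥ x + D *ᵥ e)) ⬝ᵥ (z • x - (M *ᵥ x + D *ᵥ e))).re := by
  let S : Set (ℂ × (Fin n → ℂ) × (Fin n → ℂ)) := Metric.sphere (0 : ℂ) 1 ×ˢ Metric.sphere (0 : (Fin n → ℂ) × (Fin n → ℂ)) 1
  have hS : IsCompact S := (isCompact_sphere _ _).prod (isCompact_sphere _ _)
  let f : ℂ × (Fin n → ℂ) × (Fin n → ℂ) → ℝ := fun p =>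
    (fdsSig l X Y p.2.2 (p.2.1 - (M *ᵥ p.2.1 + D *ᵥ p.2.2))).re
  let g : ℂ × (Fin n → ℂ) × (Fin n → ℂ) → ℝ := fun p => ∑ i, ‖(p.1 • p.2.1 - (M *ᵥ p.2.1 + D *ᵥ p.2.2)) i‖ ^ 2
  have hm : ∀ Q : Matrix (Fin n) (Fin n) ℂ, Continuous (fun v : (Fin n → ℂ) => Q *ᵥ v) := fun Q =>
    continuous_const.matrix_mulVec continuous_id
  have hd : ∀ u v : ℂ × (Fin n → ℂ) × (Fin n → ℂ) → (Fin n → ℂ), Continuous u → Continuous v →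
      Continuous (fun p => star (u p) ⬝ᵥ v p) := fun u v hu hv =>
    hu.star.dotProduct hv
  have hy : Continuous (fun p : ℂ × (Fin n → ℂ) × (Fin n → ℂ) => p.2.1 - (M *ᵥ p.2.1 + D *ᵥ p.2.2)) :=
    (by fun_prop : Continuous fun p : ℂ × (Fin n → ℂ) × (Fin n → ℂ) => p.2.1).sub
      (((hm M).comp (by fun_prop)).add ((hm D).comp (by fun_prop)))
  have he : Continuous (fun p : ℂ × (Fin n → ℂ) × (Fin n → ℂ) => p.2.2) := by fun_prop
  have hf : Continuous f := by
    apply Complex.continuous_re.comp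
    exact ((((continuous_const.mul (hd _ _ hy ((hm X).comp hy))).add
      (hd _ _ hy ((hm Y).comp hy))).add (hd _ _ he ((hm Y).comp hy))).add
      (hd _ _ hy ((hm Y).comp he))).sub (hd _ _ he ((hm X).comp he))
  have hw : Continuous (fun p : ℂ × (Fin n → ℂ) × (Fin n → ℂ) => p.1 • p.2.1 - (M *ᵥ p.2.1 + D *ᵥ p.2.2)) :=
    (by fun_prop : Continuous fun p : ℂ × (Fin n → ℂ) × (Fin n → ℂ) => p.1 • p.2.1).sub
      (((hm M).comp (by fun_prop)).add ((hm D).comp (by fun_prop)))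
  have hg : Continuous g :=
    continuous_finsetSum _ fun i _ => (((continuous_apply i).comp hw).norm.pow 2)
  obtain ⟨δ, hδ, C, hC, hfg⟩ := fds_compact hS f g hf hg
    (fun p _ => sum_nonneg fun _ _ => sq_nonneg _) (by
      rintro ⟨z, x, e⟩ ⟨hz, hxe⟩ h0
      refine hneg z (by simpa using hz) x e ?_ ?_
      · have := (sum_eq_zero_iff_of_nonneg (fun _ _ => sq_nonneg _)).1 h0
        apply sub_eq_zero.1
        funext i
        simpa using this i (mem_univ i)
      · intro h
        have : ‖(x, e)‖ = 1 := by simpa using hxe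
        rw [h] at this
        simp at this)
  refine ⟨δ / n, by positivity, C, hC, fun z hz x e => ?_⟩
  rw [fds_normsq, fds_normsq]
  set r := ‖(x, e)‖ with hr
  have hxr : δ / n * ∑ i, ‖x i‖ ^ 2 ≤ δ * r ^ 2 := by
    have h1 : ∀ i ∈ (univ : Finset (Fin n)), ‖x i‖ ^ 2 ≤ r ^ 2 := fun i _ => by
      have : ‖x i‖ ≤ r := (norm_le_pi_norm x i).trans (norm_fst_le (x, e))
      gcongr
    have h2 := sum_le_card_nsmul _ _ _ h1
    simp only [card_univ, Fintype.card_fin, nsmul_eq_mul] at h2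
    have hn' : (0 : ℝ) < n := by exact_mod_cast hn
    calc δ / n * ∑ i, ‖x i‖ ^ 2 ≤ δ / n * (n * r ^ 2) := by gcongr
      _ = δ * r ^ 2 := by field_simp
  suffices h : f (z, x, e) + δ * r ^ 2 ≤ C * g (z, x, e) by
    have h' : (fdsSig l X Y e (x - (M *ᵥ x + D *ᵥ e))).re + δ * r ^ 2
      ≤ C * ∑ i, ‖(z • x - (M *ᵥ x + D *ᵥ e)) i‖ ^ 2 := h
    linarith
  by_cases h0 : r = 0
  · have h1 : (x, e) = 0 := norm_eq_zero.1 h0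
    rw [Prod.mk_eq_zero] at h1
    obtain ⟨rfl, rfl⟩ := h1
    simp [f, g, h0, fdsSig]
  · have hr0 : (r : ℂ) ≠ 0 := by exact_mod_cast h0
    set x' : (Fin n → ℂ) := (r : ℂ)⁻¹ • x with hx'
    set e' : (Fin n → ℂ) := (r : ℂ)⁻¹ • e with he'
    have hx : x = (r : ℂ) • x' := by rw [hx', smul_smul, mul_inv_cancel₀ hr0, one_smul]
    have hee : e = (r : ℂ) • e' := by rw [he', smul_smul, mul_inv_cancel₀ hr0, one_smul]
    have hmem : ((z, x', e') : ℂ × (Fin n → ℂ) × (Fin n → ℂ)) ∈ S := by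
      refine ⟨by simpa using hz, ?_⟩
      have : (x', e') = (r : ℂ)⁻¹ • (x, e) := rfl
      have h2 : ‖(x', e')‖ = 1 := by
        rw [this, norm_smul, ← hr, norm_inv, Complex.norm_real, Real.norm_eq_abs,
          abs_of_nonneg (norm_nonneg _), inv_mul_cancel₀ h0]
      simpa using h2
    have h3 := hfg _ hmem
    have h4 : f (z, x, e) = r ^ 2 * f (z, x', e') := by
      have : x - (M *ᵥ x + D *ᵥ e) = (r : ℂ) • (x' - (M *ᵥ x' + D *ᵥ e')) := by
        conv_lhs => rw [hx, hee]
        simp only [mulVec_smul, smul_sub, smul_add]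
      simp only [f]
      rw [this]
      conv_lhs => rw [hee]
      rw [fdsSig_smul, Complex.re_ofReal_mul]
    have h5 : g (z, x, e) = r ^ 2 * g (z, x', e') := by
      have : z • x - (M *ᵥ x + D *ᵥ e) = (r : ℂ) • (z • x' - (M *ᵥ x' + D *ᵥ e')) := by
        conv_lhs => rw [hx, hee]
        simp only [mulVec_smul, smul_sub, smul_add, smul_comm z (r : ℂ)]
      simp only [g]
      rw [this, mul_sum]
      refine sum_congr rfl fun i _ => ?_
      rw [Pi.smul_apply, norm_smul, mul_pow, Complex.norm_real, Real.norm_eq_abs, sq_abs]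
    rw [h4, h5]
    have := mul_le_mul_of_nonneg_left h3 (sq_nonneg r)
    linarith

lemma fdsSig_parseval {n : ℕ} (N : ℕ) (hN : 0 < N) (ζ : ℂ) (hζ : IsPrimitiveRoot ζ N) (l : ℂ)
    (X Y : Matrix (Fin n) (Fin n) ℂ) (e y : ℕ → Fin n → ℂ) :
    ∑ j ∈ range N, fdsSig l X Y (fdsT N (ζ ^ j) e) (fdsT N (ζ ^ j) y)
      = N * ∑ s ∈ range N, fdsSig l X Y (e s) (y s) := by
  simp only [fdsSig, ← fdsT_mulVec, sum_add_distrib, sum_sub_distrib, ← mul_sum,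
    fds_parseval N hN ζ hζ]
  ring

lemma fds_core {n : ℕ} (l : ℂ) (X Y M D : Matrix (Fin n) (Fin n) ℂ) (ε C : ℝ)
    (h : ∀ z : ℂ, ‖z‖ = 1 → ∀ x e : Fin n → ℂ,
      (fdsSig l X Y e (x - (M *ᵥ x + D *ᵥ e))).re + ε * (star x ⬝ᵥ x).re
        ≤ C * (star (z • x - (M *ᵥ x + D *ᵥ e)) ⬝ᵥ (z • x - (M *ᵥ x + D *ᵥ e))).re)
    (N : ℕ) (hN : 0 < N) (x e : ℕ → Fin n → ℂ)
    (hx : ∀ s < N, x (s + 1) = M *ᵥ x s + D *ᵥ e s) :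
    ∑ s ∈ range N, (fdsSig l X Y (e s) (x s - x (s + 1))).re
      + ε * ∑ s ∈ range N, (star (x s) ⬝ᵥ x s).re
      ≤ C * (star (x 0 - x N) ⬝ᵥ (x 0 - x N)).re := by
  have hζ := Complex.isPrimitiveRoot_exp N hN.ne'
  set ζ := Complex.exp (2 * Real.pi * Complex.I / N)
  have hN' : (0 : ℝ) < N := by exact_mod_cast hN
  have key : ∀ j ∈ range N,
      (fdsSig l X Y (fdsT N (ζ ^ j) e) (fdsT N (ζ ^ j) (fun s => x s - x (s + 1)))).re
        + ε * (star (fdsT N (ζ ^ j) x) ⬝ᵥ fdsT N (ζ ^ j) x).re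
      ≤ C * (star (x 0 - x N) ⬝ᵥ (x 0 - x N)).re := by
    intro j _
    set u := ζ ^ j with hu
    have hnu : ‖u‖ = 1 := by rw [hu, norm_pow, hζ.norm'_eq_one hN.ne', one_pow]
    have hu0 : u ≠ 0 := by
      intro h0; rw [h0] at hnu; simp at hnu
    have huN : u ^ N = 1 := by rw [hu, ← pow_mul, mul_comm, pow_mul, hζ.pow_eq_one, one_pow]
    have h1 : fdsT N u (fun s => x (s + 1)) = M *ᵥ fdsT N u x + D *ᵥ fdsT N u e := by
      rw [← fdsT_mulVec, ← fdsT_mulVec, ← fdsT_add]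
      exact sum_congr rfl fun s hs => by simp only [hx s (mem_range.1 hs)]
    have h2 := fdsT_shift N u hu0 huN x
    have h3 := h u⁻¹ (by rw [norm_inv, hnu, inv_one]) (fdsT N u x) (fdsT N u e)
    have h4 : u⁻¹ • fdsT N u x - (M *ᵥ fdsT N u x + D *ᵥ fdsT N u e) = u⁻¹ • (x 0 - x N) := by
      rw [← h1, h2]; simp
    rw [h4, ← h1, ← fdsT_sub] at h3
    refine h3.trans_eq ?_
    congr 1
    rw [fds_normsq, fds_normsq]
    refine sum_congr rfl fun i _ => ?_
    rw [Pi.smul_apply, norm_smul, norm_inv, hnu, inv_one, one_mul]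
  have hsum := sum_le_sum key
  rw [sum_add_distrib, ← mul_sum, ← Complex.re_sum, ← Complex.re_sum, fdsSig_parseval N hN ζ hζ,
    fds_parseval N hN ζ hζ, sum_const, card_range, nsmul_eq_mul] at hsum
  have hre : ∀ w : ℂ, ((N : ℂ) * w).re = N * w.re := fun w => by
    simp
  rw [hre, hre, Complex.re_sum, Complex.re_sum] at hsum
  refine le_of_mul_le_mul_left ?_ hN'
  linarith

/-- the real supply rate -/
noncomputable def fdsR {n : ℕ} (l : ℝ) (X Y : Matrix (Fin n) (Fin n) ℝ) (e y : Fin n → ℝ) : ℝ :=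
  l * (y ⬝ᵥ (X *ᵥ y)) + y ⬝ᵥ (Y *ᵥ y) + e ⬝ᵥ (Y *ᵥ y) + y ⬝ᵥ (Y *ᵥ e) - e ⬝ᵥ (X *ᵥ e)

/-- complexification of vectors -/
def fdsC {n : ℕ} (v : Fin n → ℝ) : Fin n → ℂ := fun i => (v i : ℂ)

lemma fdsC_add {n : ℕ} (v w : Fin n → ℝ) : fdsC (v + w) = fdsC v + fdsC w := by
  funext i; simp [fdsC]

lemma fdsC_sub {n : ℕ} (v w : Fin n → ℝ) : fdsC (v - w) = fdsC v - fdsC w := by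
  funext i; simp [fdsC]

lemma fdsC_mulVec {n : ℕ} (M : Matrix (Fin n) (Fin n) ℝ) (v : Fin n → ℝ) :
    fdsC (M *ᵥ v) = M.map Complex.ofReal *ᵥ fdsC v := by
  funext i; simp [fdsC, mulVec, dotProduct]

lemma fdsC_dot {n : ℕ} (v w : Fin n → ℝ) :
    star (fdsC v) ⬝ᵥ fdsC w = ((v ⬝ᵥ w : ℝ) : ℂ) := by
  simp [fdsC, dotProduct]

lemma fdsC_sig {n : ℕ} (l : ℝ) (X Y : Matrix (Fin n) (Fin n) ℝ) (e y : Fin n → ℝ) :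
    fdsSig (l : ℂ) (X.map Complex.ofReal) (Y.map Complex.ofReal) (fdsC e) (fdsC y)
      = ((fdsR l X Y e y : ℝ) : ℂ) := by
  simp only [fdsSig, fdsR, ← fdsC_mulVec, fdsC_dot]
  push_cast
  ring

lemma fds_neg {n : ℕ} (l : ℂ) (X Y M D : Matrix (Fin n) (Fin n) ℂ)
    (hS : ∀ μ ∈ spectrum ℂ M, ‖μ‖ < 1)
    (G : ℝ → Matrix (Fin n) (Fin n) ℂ)
    (hG : ∀ ω : ℝ, G ω = (1 - M) * (Complex.exp (Complex.I * ω) • 1 - M)⁻¹ * D - D)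
    (hFDI : ∀ ω : ℝ, |ω| ≤ Real.pi →
      (-((G ω)ᴴ * (l • X + Y) * G ω + (G ω)ᴴ * Y + Y * G ω - X)).PosDef) :
    ∀ z : ℂ, ‖z‖ = 1 → ∀ x e : Fin n → ℂ, z • x = M *ᵥ x + D *ᵥ e → (x, e) ≠ 0 →
      (fdsSig l X Y e (x - (M *ᵥ x + D *ᵥ e))).re < 0 := by
  intro z hz x e hx hne
  have hzexp : Complex.exp (Complex.I * (Complex.arg z : ℝ)) = z := by
    have := Complex.norm_mul_exp_arg_mul_I z
    rw [hz] at this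
    rw [mul_comm]; simpa using this
  have hunit : IsUnit (z • (1 : Matrix (Fin n) (Fin n) ℂ) - M) := by
    by_contra h
    have : z ∈ spectrum ℂ M := by
      rw [spectrum.mem_iff, Algebra.algebraMap_eq_smul_one]; exact h
    have := hS z this
    rw [hz] at this
    exact lt_irrefl _ this
  have hdet : IsUnit (z • (1 : Matrix (Fin n) (Fin n) ℂ) - M).det :=
    (Matrix.isUnit_iff_isUnit_det _).1 hunit
  have h1 : (z • (1 : Matrix (Fin n) (Fin n) ℂ) - M) *ᵥ x = D *ᵥ e := by
    rw [sub_mulVec, smul_mulVec, one_mulVec, hx]; simp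
  have h2 : x = (z • (1 : Matrix (Fin n) (Fin n) ℂ) - M)⁻¹ *ᵥ (D *ᵥ e) := by
    rw [← h1, mulVec_mulVec, Matrix.nonsing_inv_mul _ hdet, one_mulVec]
  have he : e ≠ 0 := by
    rintro rfl
    apply hne
    rw [h2]; simp
  have hy : x - (M *ᵥ x + D *ᵥ e) = G (Complex.arg z) *ᵥ e := by
    rw [hG, hzexp, sub_mulVec, ← mulVec_mulVec, ← mulVec_mulVec, ← h2, sub_mulVec, one_mulVec]
    abel
  have hpd := (hFDI (Complex.arg z) (Complex.abs_arg_le_pi z)).dotProduct_mulVec_pos he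
  have hre := (Complex.pos_iff.1 hpd).1
  rw [hy]
  set g := G (Complex.arg z)
  have hadj : ∀ v : Fin n → ℂ, star e ⬝ᵥ (gᴴ *ᵥ v) = star (g *ᵥ e) ⬝ᵥ v := fun v => by
    rw [star_mulVec, dotProduct_mulVec]
  have hexp : star e ⬝ᵥ (-(gᴴ * (l • X + Y) * g + gᴴ * Y + Y * g - X)) *ᵥ e
      = - fdsSig l X Y e (g *ᵥ e) := by
    simp only [neg_mulVec, sub_mulVec, add_mulVec, ← mulVec_mulVec, smul_mulVec, dotProduct_neg,
      dotProduct_sub, dotProduct_add, hadj, dotProduct_smul, smul_eq_mul, fdsSig]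
    ring
  rw [hexp, Complex.neg_re] at hre
  linarith

lemma fds_interval {n : ℕ} (H h : ℕ) (hH : 1 ≤ H) (hh : h ≤ H) (X Y : Matrix (Fin n) (Fin n) ℝ)
    (hX : X.PosSemidef) (hY : Y.PosSemidef) (x : ℕ → Fin n → ℝ) :
    0 ≤ ∑ i ∈ range h, fdsR (lamMax H) X Y (x 0 - x i) (x i - x (i + 1)) := by
  have h1 := fds_vec H h hH hh X hX (fun i => x i - x (i + 1))
  simp only [sum_range_sub'] at h1
  have h2 : ∑ i ∈ range h, ((x 0 - x (i + 1)) ⬝ᵥ (Y *ᵥ (x 0 - x (i + 1)))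
      - (x 0 - x i) ⬝ᵥ (Y *ᵥ (x 0 - x i))) = (x 0 - x h) ⬝ᵥ (Y *ᵥ (x 0 - x h)) := by
    rw [sum_range_sub (fun i => (x 0 - x i) ⬝ᵥ (Y *ᵥ (x 0 - x i)))]
    simp
  have h3 : 0 ≤ (x 0 - x h) ⬝ᵥ (Y *ᵥ (x 0 - x h)) := by
    simpa using hY.dotProduct_mulVec_nonneg (x 0 - x h)
  have h4 : ∀ i, fdsR (lamMax H) X Y (x 0 - x i) (x i - x (i + 1))
      = lamMax H * ((x i - x (i + 1)) ⬝ᵥ (X *ᵥ (x i - x (i + 1))))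
        - (x 0 - x i) ⬝ᵥ (X *ᵥ (x 0 - x i))
        + ((x 0 - x (i + 1)) ⬝ᵥ (Y *ᵥ (x 0 - x (i + 1)))
          - (x 0 - x i) ⬝ᵥ (Y *ᵥ (x 0 - x i))) := fun i => by
    have : x 0 - x (i + 1) = (x 0 - x i) + (x i - x (i + 1)) := by abel
    rw [this]
    simp only [fdsR, mulVec_add, dotProduct_add, add_dotProduct]
    ring
  simp only [h4, sum_add_distrib, sum_sub_distrib, ← mul_sum]
  rw [sum_sub_distrib] at h2
  rw [h2]
  linarith

lemma fds_cumul {n : ℕ} (H : ℕ) (hH : 1 ≤ H) (X Y : Matrix (Fin n) (Fin n) ℝ)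
    (hX : X.PosSemidef) (hY : Y.PosSemidef) (x e : ℕ → Fin n → ℝ) (t : ℕ → ℕ) (ht : StrictMono t)
    (ht0 : t 0 = 0) (htH : ∀ k, t (k + 1) - t k ≤ H)
    (he : ∀ k s, t k ≤ s → s < t (k + 1) → e s = x (t k) - x s) (k : ℕ) :
    0 ≤ ∑ s ∈ range (t k), fdsR (lamMax H) X Y (e s) (x s - x (s + 1)) := by
  induction k with
  | zero => simp [ht0]
  | succ k ih =>
    have hlt : t k < t (k + 1) := ht (Nat.lt_succ_self k)
    obtain ⟨h, hh⟩ : ∃ h, t (k + 1) = t k + h := ⟨t (k + 1) - t k, by omega⟩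
    rw [hh, sum_range_add]
    refine add_nonneg ih ?_
    have h1 := fds_interval H h hH (by have := htH k; omega) X Y hX hY (fun i => x (t k + i))
    refine h1.trans_eq (sum_congr rfl fun i hi => ?_)
    have := mem_range.1 hi
    rw [he k (t k + i) (by omega) (by omega)]
    simp [add_assoc]

lemma fds_bound {n : ℕ} (hn : 1 ≤ n) (l : ℝ) (hl : 0 ≤ l) (X Y M D : Matrix (Fin n) (Fin n) ℝ)
    (hX : X.PosSemidef) (hY : Y.PosSemidef)
    (hS : ∀ μ ∈ spectrum ℂ (M.map Complex.ofReal), ‖μ‖ < 1) (ε C : ℝ) (hε : 0 < ε)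
    (h : ∀ z : ℂ, ‖z‖ = 1 → ∀ x e : Fin n → ℂ,
      (fdsSig l (X.map Complex.ofReal) (Y.map Complex.ofReal) e
          (x - (M.map Complex.ofReal *ᵥ x + D.map Complex.ofReal *ᵥ e))).re
        + ε * (star x ⬝ᵥ x).re
        ≤ C * (star (z • x - (M.map Complex.ofReal *ᵥ x + D.map Complex.ofReal *ᵥ e)) ⬝ᵥ
          (z • x - (M.map Complex.ofReal *ᵥ x + D.map Complex.ofReal *ᵥ e))).re)
    (T : ℕ) (x e : ℕ → Fin n → ℝ)
    (hx : ∀ s < T, x (s + 1) = M *ᵥ x s + D *ᵥ e s)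
    (hsig : 0 ≤ ∑ s ∈ range T, fdsR l X Y (e s) (x s - x (s + 1))) :
    ε * ∑ s ∈ range T, x s ⬝ᵥ x s ≤ C * (x 0 ⬝ᵥ x 0) := by
  set x' : ℕ → Fin n → ℝ := fun s => if s < T then x s else (M ^ (s - T)) *ᵥ x T with hx'
  set e' : ℕ → Fin n → ℝ := fun s => if s < T then e s else 0 with he'
  have hx'T : ∀ s ≤ T, x' s = x s := fun s hs => by
    rcases hs.lt_or_eq with h1 | rfl
    · simp [hx', h1]
    · simp [hx']
  have hdyn : ∀ s, x' (s + 1) = M *ᵥ x' s + D *ᵥ e' s := fun s => by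
    by_cases h1 : s < T
    · rw [hx'T (s + 1) h1, hx'T s h1.le, hx s h1]
      simp [he', h1]
    · have h2 : ¬ s + 1 < T := by omega
      have h3 : s + 1 - T = (s - T) + 1 := by omega
      simp only [hx', he', h1, h2, if_false, h3, mulVec_zero, add_zero, mulVec_mulVec, pow_succ']
  have hX0 : ∀ v : Fin n → ℝ, 0 ≤ v ⬝ᵥ (X *ᵥ v) := fun v => by
    simpa using hX.dotProduct_mulVec_nonneg v
  have hY0 : ∀ v : Fin n → ℝ, 0 ≤ v ⬝ᵥ (Y *ᵥ v) := fun v => by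
    simpa using hY.dotProduct_mulVec_nonneg v
  have hd0 : ∀ v : Fin n → ℝ, 0 ≤ v ⬝ᵥ v := fun v =>
    sum_nonneg fun i _ => mul_self_nonneg _
  have key : ∀ k : ℕ, ε * ∑ s ∈ range T, x s ⬝ᵥ x s
      ≤ C * ((x 0 - M ^ (k + 1) *ᵥ x T) ⬝ᵥ (x 0 - M ^ (k + 1) *ᵥ x T)) := fun k => by
    have h1 := fds_core (l : ℂ) (X.map Complex.ofReal) (Y.map Complex.ofReal)
      (M.map Complex.ofReal) (D.map Complex.ofReal) ε C h (T + (k + 1)) (by omega)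
      (fun s => fdsC (x' s)) (fun s => fdsC (e' s)) (fun s _ => by
        simp only [hdyn s, fdsC_add, fdsC_mulVec])
    simp only [← fdsC_sub, fdsC_sig, fdsC_dot, Complex.ofReal_re] at h1
    have h2 : x' (T + (k + 1)) = M ^ (k + 1) *ᵥ x T := by simp [hx']
    rw [h2, hx'T 0 (Nat.zero_le _)] at h1
    rw [sum_range_add, sum_range_add (fun s => x' s ⬝ᵥ x' s)] at h1
    have h3 : ∑ s ∈ range T, fdsR l X Y (e' s) (x' s - x' (s + 1))
        = ∑ s ∈ range T, fdsR l X Y (e s) (x s - x (s + 1)) :=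
      sum_congr rfl fun s hs => by
        have := mem_range.1 hs
        rw [hx'T s this.le, hx'T (s + 1) this]
        simp [he', this]
    have h4 : ∑ s ∈ range T, x' s ⬝ᵥ x' s = ∑ s ∈ range T, x s ⬝ᵥ x s :=
      sum_congr rfl fun s hs => by rw [hx'T s (mem_range.1 hs).le]
    have h5 : 0 ≤ ∑ i ∈ range (k + 1), fdsR l X Y (e' (T + i)) (x' (T + i) - x' (T + i + 1)) :=
      sum_nonneg fun i _ => by
        have : e' (T + i) = 0 := by simp [he']
        rw [this]
        simp only [fdsR, zero_dotProduct, mulVec_zero, dotProduct_zero, add_zero, sub_zero]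
        exact add_nonneg (mul_nonneg hl (hX0 _)) (hY0 _)
    have h6 : 0 ≤ ∑ i ∈ range (k + 1), x' (T + i) ⬝ᵥ x' (T + i) := sum_nonneg fun i _ => hd0 _
    rw [h3, h4] at h1
    have := mul_nonneg hε.le h6
    linarith
  have hlim := (fds_pow_tendsto hn M hS (x T)).comp (Filter.tendsto_add_atTop_nat 1)
  have hsub : Filter.Tendsto (fun k : ℕ => x 0 - M ^ (k + 1) *ᵥ x T) Filter.atTop (nhds (x 0)) := by
    simpa using tendsto_const_nhds (x := x 0).sub hlim
  have hcont : Continuous fun v : Fin n → ℝ => C * (v ⬝ᵥ v) :=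
    continuous_const.mul (continuous_id.dotProduct continuous_id)
  exact ge_of_tendsto' ((hcont.tendsto _).comp hsub) key

/-- Frequency-domain stability criterion: if `A + BK` is Schur and the frequency-domain
inequality with multipliers `X ≻ 0`, `Y ⪰ 0` holds on the unit circle, then the
aperiodically sampled closed loop is asymptotically stable for all sampling patterns
with intervals in `{1,…,h̄}`. -/
theorem frequency_domain_stability
    (n m : ℕ) (hn : 1 ≤ n) (hm : 1 ≤ m)
    (A : Matrix (Fin n) (Fin n) ℝ) (B : Matrix (Fin n) (Fin m) ℝ)
    (K : Matrix (Fin m) (Fin n) ℝ) (hbar : ℕ) (hhbar : 1 ≤ hbar)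
    (hSchur : ∀ μ ∈ spectrum ℂ ((A + B * K).map (Complex.ofReal)), ‖μ‖ < 1)
    (G : ℝ → Matrix (Fin n) (Fin n) ℂ)
    (hG : ∀ ω : ℝ, G ω =
      ((1 : Matrix (Fin n) (Fin n) ℂ) - (A + B * K).map Complex.ofReal)
        * (Complex.exp (Complex.I * ω) • (1 : Matrix (Fin n) (Fin n) ℂ)
            - (A + B * K).map Complex.ofReal)⁻¹
        * (B.map Complex.ofReal * K.map Complex.ofReal)
      - B.map Complex.ofReal * K.map Complex.ofReal)
    (X Y : Matrix (Fin n) (Fin n) ℝ) (hX : X.PosDef) (hY : Y.PosSemidef)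
    (hFDI : ∀ ω : ℝ, |ω| ≤ Real.pi →
      (-(((G ω)ᴴ * (((lamMax hbar : ℂ) • X.map Complex.ofReal + Y.map Complex.ofReal))
            * G ω)
          + (G ω)ᴴ * Y.map Complex.ofReal + Y.map Complex.ofReal * G ω
          - X.map Complex.ofReal)).PosDef) :
    (∀ t : ℕ → ℕ, StrictMono t → t 0 = 0 → (∀ k : ℕ, t (k + 1) - t k ≤ hbar) →
      ∀ (x₀ : EuclideanSpace ℝ (Fin n)) (x : ℕ → EuclideanSpace ℝ (Fin n)),
        IsTraj A B K t x₀ x → Filter.Tendsto x Filter.atTop (nhds 0)) ∧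
    (∀ ε : ℝ, 0 < ε → ∃ δ : ℝ, 0 < δ ∧
      ∀ t : ℕ → ℕ, StrictMono t → t 0 = 0 → (∀ k : ℕ, t (k + 1) - t k ≤ hbar) →
        ∀ (x₀ : EuclideanSpace ℝ (Fin n)) (x : ℕ → EuclideanSpace ℝ (Fin n)),
          IsTraj A B K t x₀ x → ‖x₀‖ < δ → ∀ s : ℕ, ‖x s‖ < ε) := by
  have hmapBK : B.map Complex.ofReal * K.map Complex.ofReal = (B * K).map Complex.ofReal :=
    (Matrix.map_mul (f := Complex.ofRealHom)).symm
  have hl := fds_lam_nonneg hbar hhbar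
  obtain ⟨η, hη, C, hC, hpt⟩ := fds_point hn (lamMax hbar : ℂ) (X.map Complex.ofReal)
    (Y.map Complex.ofReal) ((A + B * K).map Complex.ofReal) ((B * K).map Complex.ofReal)
    (fds_neg _ _ _ _ _ hSchur G (fun ω => by rw [hG ω, hmapBK]) hFDI)
  have main : ∀ t : ℕ → ℕ, StrictMono t → t 0 = 0 → (∀ k : ℕ, t (k + 1) - t k ≤ hbar) →
      ∀ (x₀ : EuclideanSpace ℝ (Fin n)) (x : ℕ → EuclideanSpace ℝ (Fin n)),
        IsTraj A B K t x₀ x → ∀ N, ∑ s ∈ range N, ‖x s‖ ^ 2 ≤ (C / η + 1) * ‖x₀‖ ^ 2 := by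
    intro t ht ht0 hth x₀ x hx N
    have hns : ∀ v : EuclideanSpace ℝ (Fin n), ‖v‖ ^ 2 = v.ofLp ⬝ᵥ v.ofLp := fun v => by
      rw [EuclideanSpace.real_norm_sq_eq]; simp [dotProduct, sq]
    have hex : ∀ s, ∃ k, t k ≤ s ∧ s < t (k + 1) := by
      intro s
      have hle : ∀ k, k ≤ t k := fun k => ht.le_apply
      refine ⟨Nat.findGreatest (fun k => t k ≤ s) s, ?_, ?_⟩
      · exact Nat.findGreatest_spec (P := fun k => t k ≤ s) (Nat.zero_le s) (by simp [ht0])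
      · by_contra hcon
        have h1 : t (Nat.findGreatest (fun k => t k ≤ s) s + 1) ≤ s := not_lt.1 hcon
        have h2 := Nat.le_findGreatest (P := fun k => t k ≤ s) ((hle _).trans h1) h1
        omega
    choose κ hκ1 hκ2 using hex
    have hκ : ∀ k s, t k ≤ s → s < t (k + 1) → κ s = k := by
      intro k s h1 h2
      have h3 : κ s < k + 1 := ht.lt_iff_lt.1 ((hκ1 s).trans_lt h2)
      have h4 : k < κ s + 1 := ht.lt_iff_lt.1 (h1.trans_lt (hκ2 s))
      omega
    let e : ℕ → Fin n → ℝ := fun s => (x (t (κ s))).ofLp - (x s).ofLp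
    have hdyn : ∀ s, (x (s + 1)).ofLp = (A + B * K) *ᵥ (x s).ofLp + (B * K) *ᵥ e s := by
      intro s
      rw [hx.2 (κ s) s (hκ1 s) (hκ2 s)]
      simp only [e, add_mulVec, mulVec_sub, mulVec_mulVec]
      abel
    have hcum := fds_cumul hbar hhbar X Y hX.posSemidef hY (fun s => (x s).ofLp) e t ht ht0 hth
      (fun k s h1 h2 => by simp only [e, hκ k s h1 h2]) N
    have hb := fds_bound hn (lamMax hbar) hl X Y (A + B * K) (B * K) hX.posSemidef hY hSchur η C hη
      hpt (t N) (fun s => (x s).ofLp) e (fun s _ => hdyn s) hcum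
    simp only [← hns] at hb
    rw [hx.1] at hb
    have hsub : ∑ s ∈ range N, ‖x s‖ ^ 2 ≤ ∑ s ∈ range (t N), ‖x s‖ ^ 2 :=
      sum_le_sum_of_subset_of_nonneg (range_subset_range.2 ht.le_apply) fun _ _ _ => sq_nonneg _
    have h1 : ∑ s ∈ range (t N), ‖x s‖ ^ 2 ≤ C / η * ‖x₀‖ ^ 2 := by
      rw [div_mul_eq_mul_div, le_div_iff₀ hη]; linarith
    nlinarith [sq_nonneg ‖x₀‖]
  have hc : 0 < C / η + 1 := by positivity
  constructor
  · intro t ht ht0 hth x₀ x hx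
    have hsum : Summable (fun s => ‖x s‖ ^ 2) :=
      summable_of_sum_range_le (fun _ => sq_nonneg _) (main t ht ht0 hth x₀ x hx)
    have h1 := hsum.tendsto_atTop_zero
    rw [tendsto_zero_iff_norm_tendsto_zero]
    have h2 := (Real.continuous_sqrt.tendsto _).comp h1
    simpa [Function.comp_def, Real.sqrt_sq] using h2
  · intro ε hε
    refine ⟨ε / Real.sqrt (C / η + 1), by positivity, ?_⟩
    intro t ht ht0 hth x₀ x hx hx0 s
    have h1 := main t ht ht0 hth x₀ x hx (s + 1)
    have h2 : ‖x s‖ ^ 2 ≤ ∑ s ∈ range (s + 1), ‖x s‖ ^ 2 :=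
      single_le_sum (f := fun s => ‖x s‖ ^ 2) (fun _ _ => sq_nonneg _) (self_mem_range_succ s)
    rw [lt_div_iff₀ (by positivity)] at hx0
    have h3 : (‖x₀‖ * Real.sqrt (C / η + 1)) ^ 2 < ε ^ 2 := by gcongr
    rw [mul_pow, Real.sq_sqrt hc.le] at h3
    refine lt_of_pow_lt_pow_left₀ 2 hε.le ?_
    linarith
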